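/- arXiv:1301.2061 — 2 statements merged into one kernel-verified Lean document; each statement's English description precedes it below -/
import Mathlib

section
/- There exists a universal constant A > 0 such that for every probability measure μ on ℝ with infinite support and all moments finite, every bounded measurable function f : ℝ → ℝ, every ε > 0 and every n ∈ ℕ, the orthogonal polynomial ensemble of size n associated with μ satisfies P( |X_f^{(n)}/n − E[X_f^{(n)}]/n| ≥ ε ) ≤ 2·exp( − n ε · min( ε/(8A‖f‖_∞²), 1/(6‖f‖_∞) ) ). (One may take A = 2e² Σ_{m=0}^∞ (e/3)^m (m+2)^{3/2}.) -/
open MeasureTheory ProbabilityTheory Filter Topology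

noncomputable section

/-- The squared Vandermonde determinant `∏_{i>j} (λ_i - λ_j)^2`. -/
def vandSq {n : ℕ} (l : Fin n → ℝ) : ℝ :=
  ∏ q ∈ Finset.univ.filter (fun q : Fin n × Fin n => q.2 < q.1), (l q.1 - l q.2) ^ 2

/-- The orthogonal polynomial ensemble of size `n` associated with `μ`: the probability
measure on `ℝ^n` proportional to `∏_{i>j}(λ_i-λ_j)^2 dμ(λ_1)⋯dμ(λ_n)`. -/
def OPE (μ : Measure ℝ) (n : ℕ) : Measure (Fin n → ℝ) :=
  ((((Measure.pi fun _ : Fin n => μ).withDensity fun l => ENNReal.ofReal (vandSq l))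
    Set.univ)⁻¹) •
    ((Measure.pi fun _ : Fin n => μ).withDensity fun l => ENNReal.ofReal (vandSq l))

/-- The linear statistic `X_f = ∑ f(λ_j)`. -/
def linStat {n : ℕ} (f : ℝ → ℝ) (l : Fin n → ℝ) : ℝ := ∑ j, f (l j)

/-- The scaled linear statistic `X_{f,α,x*} = ∑ f(n^α (λ_j - x*))`. -/
def scaledLinStat {n : ℕ} (f : ℝ → ℝ) (α xs : ℝ) (l : Fin n → ℝ) : ℝ :=
  ∑ j, f ((n : ℝ) ^ α * (l j - xs))

/-- `p` is the family of orthonormal polynomials of `μ`: `p j` has degree `j`, positive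
leading coefficient, and `∫ p_i p_j dμ = δ_{ij}`. -/
def IsOrthonormalPolys (μ : Measure ℝ) (p : ℕ → Polynomial ℝ) : Prop :=
  (∀ j, (p j).degree = (j : WithBot ℕ)) ∧ (∀ j, 0 < (p j).leadingCoeff) ∧
    ∀ i j, ∫ x, (p i).eval x * (p j).eval x ∂μ = if i = j then 1 else 0

/-- All moments of `μ` are finite. -/
def HasAllMoments (μ : Measure ℝ) : Prop := ∀ k : ℕ, Integrable (fun x : ℝ => x ^ k) μ

/-- `μ` has infinite support: no finite set carries full `μ`-measure. -/
def InfiniteSupport (μ : Measure ℝ) : Prop := ∀ s : Finset ℝ, μ ((↑s : Set ℝ)ᶜ) ≠ 0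

/-- The Christoffel–Darboux kernel `K_n(x,y) = ∑_{j<n} p_j(x) p_j(y)`. -/
def CDKernel (p : ℕ → Polynomial ℝ) (n : ℕ) (x y : ℝ) : ℝ :=
  ∑ j ∈ Finset.range n, (p j).eval x * (p j).eval y

/-- The sup norm `‖f‖_∞` of a (bounded) function. -/
def supNorm (f : ℝ → ℝ) : ℝ := ⨆ x, |f x|

/-- The (topological) support of a measure on `ℝ`. -/
def measSupport (μ : Measure ℝ) : Set ℝ := {x | ∀ U ∈ 𝓝 x, μ U ≠ 0}

/-- The sine kernel `sin(πt)/(πt)` (equal to `1` at `t = 0`). -/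
def sineKernel (t : ℝ) : ℝ := if t = 0 then 1 else Real.sin (Real.pi * t) / (Real.pi * t)

/-- `K̃_n(x,y) = w(x)^{1/2} w(y)^{1/2} K_n(x,y)`, where `w` is the Radon–Nikodym
derivative of `μ` with respect to Lebesgue measure. -/
def tildeK (μ : Measure ℝ) (Kf : ℝ → ℝ → ℝ) (x y : ℝ) : ℝ :=
  Real.sqrt ((μ.rnDeriv volume x).toReal) * Real.sqrt ((μ.rnDeriv volume y).toReal) * Kf x y

/-- The Nevai condition at `x*` for a sequence of measures with kernels `Kf n`. -/
def NevaiCond (μ : ℕ → Measure ℝ) (Kf : ℕ → ℝ → ℝ → ℝ) (xs : ℝ) : Prop :=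
  ∀ f : ℝ → ℝ, Continuous f → HasCompactSupport f →
    Tendsto (fun n => ∫ y, (f y - f xs) * Kf n xs y ^ 2 / Kf n xs xs ∂(μ n)) atTop (𝓝 0)

/-- The `α`-Nevai condition at `x*` for a sequence of measures with kernels `Kf n`. -/
def AlphaNevaiCond (μ : ℕ → Measure ℝ) (Kf : ℕ → ℝ → ℝ → ℝ) (α xs : ℝ) : Prop :=
  ∀ f : ℝ → ℝ, Continuous f → HasCompactSupport f →
    ∀ S : Set ℝ, IsCompact S →
      TendstoUniformlyOn
        (fun n s => ∫ y, (f s - f ((n : ℝ) ^ α * (y - xs))) *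
            Kf n (xs + s / (n : ℝ) ^ α) y ^ 2 /
            Kf n (xs + s / (n : ℝ) ^ α) (xs + s / (n : ℝ) ^ α) ∂(μ n))
        (fun _ => 0) atTop S

open scoped MatrixOrder ComplexOrder in
/-- For `H` positive definite and `H + B` positive semidefinite, `det (H + sB) / det H` is a
polynomial in `s` with first-order coefficient `T`, and its value at `1` is at most `exp T`. -/
lemma exists_det_add_smul_eq_and_det_add_le_exp {ι : Type*} [Fintype ι] [DecidableEq ι]
    {H B : Matrix ι ι ℝ} (hH : H.PosDef) (hHB : (H + B).PosSemidef) :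
    ∃ (T : ℝ) (q : Polynomial ℝ),
      (∀ s : ℝ, (H + s • B).det = H.det * (1 + T * s + q.eval s * s ^ 2)) ∧
        (H + B).det ≤ H.det * Real.exp T := by
  obtain ⟨C, rfl⟩ := CStarAlgebra.nonneg_iff_eq_star_mul_self.mp hH.posSemidef.nonneg
  rw [Matrix.star_eq_conjTranspose] at *
  have hdet : IsUnit C.det := by
    have := hH.det_pos
    rw [Matrix.det_mul] at this
    exact isUnit_iff_ne_zero.mpr (right_ne_zero_of_mul this.ne')
  have hCt : IsUnit C.conjTranspose.det := by simpa [Matrix.det_conjTranspose] using hdet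
  set M := (C⁻¹).conjTranspose * B * C⁻¹ with hM
  have hB : C.conjTranspose * M * C = B := by
    rw [hM, Matrix.conjTranspose_nonsing_inv]
    simp only [Matrix.mul_assoc]
    rw [Matrix.nonsing_inv_mul _ hdet, Matrix.mul_one, Matrix.mul_nonsing_inv_cancel_left _ _ hCt]
  have hfac (s : ℝ) : C.conjTranspose * C + s • B = C.conjTranspose * (1 + s • M) * C := by
    rw [Matrix.mul_add, Matrix.add_mul, Matrix.mul_one, Matrix.mul_smul, Matrix.smul_mul, hB]
  have hdet_fac (s : ℝ) :
      (C.conjTranspose * C + s • B).det = (C.conjTranspose * C).det * (1 + s • M).det := by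
    rw [hfac, Matrix.det_mul, Matrix.det_mul, Matrix.det_mul]; ring
  have hpsd : (1 + M).PosSemidef := by
    have h := hHB.conjTranspose_mul_mul_same C⁻¹
    have h1 := hfac 1
    rw [one_smul, one_smul] at h1
    rw [h1, Matrix.conjTranspose_nonsing_inv] at h
    simp only [Matrix.mul_assoc] at h
    rwa [Matrix.mul_nonsing_inv _ hdet, Matrix.mul_one,
      Matrix.nonsing_inv_mul_cancel_left _ _ hCt] at h
  refine ⟨M.trace, _, fun s => by rw [hdet_fac, Matrix.det_one_add_smul], ?_⟩
  have h1 := hdet_fac 1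
  rw [one_smul, one_smul] at h1
  rw [h1]
  refine mul_le_mul_of_nonneg_left ?_ hH.det_pos.le
  have htr : M.trace = ∑ i, (hpsd.isHermitian.eigenvalues i - 1) := by
    have := hpsd.isHermitian.trace_eq_sum_eigenvalues
    rw [Matrix.trace_add, Matrix.trace_one] at this
    simp at this
    simp [← this]
  rw [hpsd.isHermitian.det_eq_prod_eigenvalues, htr, Real.exp_sum]
  exact Finset.prod_le_prod (fun i _ => by simpa using hpsd.eigenvalues_nonneg i)
    fun i _ => by simpa using Real.add_one_le_exp (hpsd.isHermitian.eigenvalues i - 1)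

/-- The matrix of moments `∫ g(x) x^{i+j} dμ(x)`, `0 ≤ i, j < n`, of `μ` with weight `g`. -/
def momentMatrix (μ : Measure ℝ) (n : ℕ) (g : ℝ → ℝ) : Matrix (Fin n) (Fin n) ℝ :=
  Matrix.of fun i j => ∫ x, g x * (x ^ (i : ℕ) * x ^ (j : ℕ)) ∂μ

lemma HasAllMoments.integrable_mul_pow_mul_pow {μ : Measure ℝ} (hm : HasAllMoments μ)
    {g : ℝ → ℝ} (hg : Measurable g) {C : ℝ} (hC : ∀ x, |g x| ≤ C) (i j : ℕ) :
    Integrable (fun x => g x * (x ^ i * x ^ j)) μ := by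
  simp_rw [← pow_add]
  exact (hm (i + j)).bdd_mul hg.aestronglyMeasurable (ae_of_all _ hC)

lemma dotProduct_momentMatrix_mulVec {μ : Measure ℝ} (hm : HasAllMoments μ) (n : ℕ)
    {g : ℝ → ℝ} (hg : Measurable g) {C : ℝ} (hC : ∀ x, |g x| ≤ C) (v : Fin n → ℝ) :
    star v ⬝ᵥ (momentMatrix μ n g).mulVec v =
      ∫ x, g x * (∑ i, v i * x ^ (i : ℕ)) ^ 2 ∂μ := by
  have hint (i j : Fin n) := hm.integrable_mul_pow_mul_pow hg hC i j
  have hexp (x : ℝ) : g x * (∑ i, v i * x ^ (i : ℕ)) ^ 2 =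
      ∑ i, ∑ j, v i * v j * (g x * (x ^ (i : ℕ) * x ^ (j : ℕ))) := by
    rw [sq, Finset.sum_mul_sum, Finset.mul_sum]
    refine Finset.sum_congr rfl fun i _ => ?_
    rw [Finset.mul_sum]
    exact Finset.sum_congr rfl fun j _ => by ring
  simp_rw [hexp]
  rw [integral_finsetSum _ fun i _ => integrable_finsetSum _ fun j _ => (hint i j).const_mul _]
  simp only [dotProduct, Matrix.mulVec, momentMatrix, Matrix.of_apply, Pi.star_apply, star_trivial]
  refine Finset.sum_congr rfl fun i _ => ?_
  rw [integral_finsetSum _ fun j _ => (hint i j).const_mul _, Finset.mul_sum]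
  refine Finset.sum_congr rfl fun j _ => ?_
  rw [integral_const_mul]
  ring

lemma isHermitian_momentMatrix (μ : Measure ℝ) (n : ℕ) (g : ℝ → ℝ) :
    (momentMatrix μ n g).IsHermitian := by
  ext i j
  simp [momentMatrix, mul_comm]

lemma posSemidef_momentMatrix {μ : Measure ℝ} (hm : HasAllMoments μ) (n : ℕ)
    {g : ℝ → ℝ} (hg : Measurable g) {C : ℝ} (hC : ∀ x, |g x| ≤ C) (h0 : ∀ x, 0 ≤ g x) :
    (momentMatrix μ n g).PosSemidef := by
  refine .of_dotProduct_mulVec_nonneg (isHermitian_momentMatrix μ n g) fun v => ?_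
  rw [dotProduct_momentMatrix_mulVec hm n hg hC]
  exact integral_nonneg fun x => mul_nonneg (h0 x) (sq_nonneg _)

lemma posDef_momentMatrix_one {μ : Measure ℝ} (hs : InfiniteSupport μ) (hm : HasAllMoments μ)
    (n : ℕ) : (momentMatrix μ n fun _ => 1).PosDef := by
  refine .of_dotProduct_mulVec_pos (isHermitian_momentMatrix μ n _) fun v hv => ?_
  rw [dotProduct_momentMatrix_mulVec hm n measurable_const (C := 1) (by simp)]
  simp only [one_mul]
  set P : Polynomial ℝ := ∑ i : Fin n, Polynomial.monomial (i : ℕ) (v i) with hP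
  have heval (x : ℝ) : ∑ i, v i * x ^ (i : ℕ) = P.eval x := by
    simp [hP, Polynomial.eval_finsetSum]
  have hP0 : P ≠ 0 := by
    intro h
    apply hv
    ext k
    have := congrArg (fun Q => Polynomial.coeff Q (k : ℕ)) h
    simpa [hP, Polynomial.finsetSum_coeff, Polynomial.coeff_monomial, Fin.val_inj] using this
  simp_rw [heval]
  have hint : Integrable (fun x => P.eval x ^ 2) μ := by
    simp_rw [← Polynomial.eval_pow, Polynomial.eval_eq_sum_range]
    exact integrable_finsetSum _ fun i _ => (hm i).const_mul _
  refine lt_of_le_of_ne (integral_nonneg fun x => sq_nonneg _) fun h => ?_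
  have hae := (integral_eq_zero_iff_of_nonneg (fun x => sq_nonneg _) hint).mp h.symm
  refine hs P.roots.toFinset (measure_mono_null (fun x hx => ?_) hae)
  simpa [hP0] using hx

lemma momentMatrix_one_add_smul {μ : Measure ℝ} (hm : HasAllMoments μ) {n : ℕ}
    {g : ℝ → ℝ} {C : ℝ} (hg : Measurable g) (hC : ∀ x, |g x| ≤ C) (s : ℝ) :
    momentMatrix μ n (fun x => 1 + s * g x) =
      momentMatrix μ n (fun _ => 1) + s • momentMatrix μ n g := by
  ext i j
  have h1 := hm.integrable_mul_pow_mul_pow (g := fun _ => 1) measurable_const (C := 1)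
    (by simp) i j
  have h2 := (hm.integrable_mul_pow_mul_pow hg hC i j).const_mul s
  simp only [momentMatrix, Matrix.of_apply, Matrix.add_apply, Matrix.smul_apply, smul_eq_mul]
  rw [← integral_const_mul, ← integral_add h1 h2]
  exact integral_congr_ae (ae_of_all _ fun x => by ring)

lemma vandSq_eq_det_sq {n : ℕ} (l : Fin n → ℝ) :
    vandSq l = (Matrix.vandermonde l).transpose.det ^ 2 := by
  rw [Matrix.det_transpose, Matrix.det_vandermonde, ← Finset.prod_pow, vandSq,
    Finset.prod_filter, Fintype.prod_prod_type, Finset.prod_comm]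
  refine Finset.prod_congr rfl fun i _ => ?_
  rw [← Finset.prod_pow, ← Finset.prod_filter]
  refine Finset.prod_congr ?_ fun _ _ => rfl
  ext j
  simp

lemma vandSq_nonneg {n : ℕ} (l : Fin n → ℝ) : 0 ≤ vandSq l :=
  Finset.prod_nonneg fun _ _ => sq_nonneg _

lemma measurable_vandSq {n : ℕ} : Measurable (vandSq : (Fin n → ℝ) → ℝ) := by
  unfold vandSq
  fun_prop

lemma prod_mul_vandSq_eq_sum {n : ℕ} (g : ℝ → ℝ) (l : Fin n → ℝ) :
    (∏ j, g (l j)) * vandSq l = ∑ σ : Equiv.Perm (Fin n), ∑ τ : Equiv.Perm (Fin n),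
      (((σ.sign : ℤ) : ℝ) * ((τ.sign : ℤ) : ℝ)) *
        ∏ j, g (l j) * (l j ^ (σ j : ℕ) * l j ^ (τ j : ℕ)) := by
  rw [vandSq_eq_det_sq, sq, Matrix.det_apply', Finset.sum_mul_sum, Finset.mul_sum]
  refine Finset.sum_congr rfl fun σ _ => ?_
  rw [Finset.mul_sum]
  refine Finset.sum_congr rfl fun τ _ => ?_
  simp only [Matrix.transpose_apply, Matrix.vandermonde_apply, Finset.prod_mul_distrib]
  ring

section

variable {μ : Measure ℝ} [IsProbabilityMeasure μ] {n : ℕ} {g : ℝ → ℝ} {C : ℝ}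

lemma HasAllMoments.integrable_prod_mul_pow (hm : HasAllMoments μ)
    (hg : Measurable g) (hC : ∀ x, |g x| ≤ C) (σ τ : Equiv.Perm (Fin n)) :
    Integrable (fun l : Fin n → ℝ => ∏ j, g (l j) * (l j ^ (σ j : ℕ) * l j ^ (τ j : ℕ)))
      (Measure.pi fun _ => μ) :=
  Integrable.fintype_prod (f := fun j x => g x * (x ^ (σ j : ℕ) * x ^ (τ j : ℕ)))
    fun _ => hm.integrable_mul_pow_mul_pow hg hC _ _

lemma HasAllMoments.integrable_prod_mul_vandSq (hm : HasAllMoments μ)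
    (hg : Measurable g) (hC : ∀ x, |g x| ≤ C) :
    Integrable (fun l : Fin n → ℝ => (∏ j, g (l j)) * vandSq l) (Measure.pi fun _ => μ) := by
  simp_rw [prod_mul_vandSq_eq_sum]
  exact integrable_finsetSum _ fun σ _ => integrable_finsetSum _ fun τ _ =>
    (hm.integrable_prod_mul_pow hg hC σ τ).const_mul _

/-- The **Andréief identity** for monomials. -/
lemma integral_prod_mul_vandSq (hm : HasAllMoments μ)
    (hg : Measurable g) (hC : ∀ x, |g x| ≤ C) :
    ∫ l : Fin n → ℝ, (∏ j, g (l j)) * vandSq l ∂(Measure.pi fun _ => μ) =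
      n.factorial * (momentMatrix μ n g).det := by
  have hint (σ τ : Equiv.Perm (Fin n)) := (hm.integrable_prod_mul_pow hg hC σ τ).const_mul
    (((σ.sign : ℤ) : ℝ) * ((τ.sign : ℤ) : ℝ))
  have hterm (σ τ : Equiv.Perm (Fin n)) :
      ∫ l : Fin n → ℝ, ∏ j, g (l j) * (l j ^ (σ j : ℕ) * l j ^ (τ j : ℕ))
        ∂(Measure.pi fun _ => μ) = ∏ j, momentMatrix μ n g (σ j) (τ j) :=
    integral_fintype_prod_eq_prod fun j x => g x * (x ^ (σ j : ℕ) * x ^ (τ j : ℕ))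
  simp_rw [prod_mul_vandSq_eq_sum]
  rw [integral_finsetSum _ fun σ _ => integrable_finsetSum _ fun τ _ => hint σ τ]
  simp_rw [integral_finsetSum _ fun τ _ => hint _ τ, integral_const_mul, hterm]
  rw [Finset.sum_comm]
  have hdet (τ : Equiv.Perm (Fin n)) :
      ∑ σ : Equiv.Perm (Fin n), (((σ.sign : ℤ) : ℝ) * ((τ.sign : ℤ) : ℝ)) *
        ∏ j, momentMatrix μ n g (σ j) (τ j) = (momentMatrix μ n g).det := by
    have h := Matrix.det_permute' τ (momentMatrix μ n g)
    rw [Matrix.det_apply'] at h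
    simp only [Matrix.submatrix_apply, id] at h
    have hsq : ((τ.sign : ℤ) : ℝ) * ((τ.sign : ℤ) : ℝ) = 1 := by
      rcases Int.units_eq_one_or τ.sign with h | h <;> simp [h]
    calc _ = ((τ.sign : ℤ) : ℝ) * ∑ σ : Equiv.Perm (Fin n), ((σ.sign : ℤ) : ℝ) *
          ∏ j, momentMatrix μ n g (σ j) (τ j) := by
          rw [Finset.mul_sum]; exact Finset.sum_congr rfl fun σ _ => by ring
      _ = _ := by rw [h, ← mul_assoc, hsq, one_mul]
  simp [hdet, Fintype.card_perm]

lemma integral_vandSq_eq (hm : HasAllMoments μ) :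
    ∫ l : Fin n → ℝ, vandSq l ∂(Measure.pi fun _ => μ) =
      n.factorial * (momentMatrix μ n fun _ => 1).det := by
  simpa using integral_prod_mul_vandSq (n := n) hm (g := fun _ => 1) measurable_const (C := 1)
    (by simp)

lemma integral_vandSq_pos (hs : InfiniteSupport μ) (hm : HasAllMoments μ) :
    0 < ∫ l : Fin n → ℝ, vandSq l ∂(Measure.pi fun _ => μ) := by
  rw [integral_vandSq_eq hm]
  exact mul_pos (by positivity) (posDef_momentMatrix_one hs hm n).det_pos

lemma withDensity_vandSq_univ (hm : HasAllMoments μ) :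
    ((Measure.pi fun _ : Fin n => μ).withDensity fun l => ENNReal.ofReal (vandSq l)) Set.univ =
      ENNReal.ofReal (∫ l : Fin n → ℝ, vandSq l ∂(Measure.pi fun _ => μ)) := by
  have hint : Integrable (vandSq : (Fin n → ℝ) → ℝ) (Measure.pi fun _ => μ) := by
    simpa using hm.integrable_prod_mul_vandSq (n := n) (g := fun _ => 1) measurable_const (C := 1)
      (by simp)
  rw [withDensity_apply _ MeasurableSet.univ, Measure.restrict_univ,
    ofReal_integral_eq_lintegral_ofReal hint (ae_of_all _ vandSq_nonneg)]

lemma isProbabilityMeasure_OPE (hs : InfiniteSupport μ) (hm : HasAllMoments μ) :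
    IsProbabilityMeasure (OPE μ n) := by
  constructor
  rw [OPE, Measure.smul_apply, smul_eq_mul, withDensity_vandSq_univ hm]
  exact ENNReal.inv_mul_cancel (by simpa using integral_vandSq_pos hs hm) ENNReal.ofReal_ne_top

lemma integral_OPE (hs : InfiniteSupport μ) (hm : HasAllMoments μ) (G : (Fin n → ℝ) → ℝ) :
    ∫ l, G l ∂(OPE μ n) = (∫ l : Fin n → ℝ, vandSq l ∂(Measure.pi fun _ => μ))⁻¹ *
      ∫ l : Fin n → ℝ, G l * vandSq l ∂(Measure.pi fun _ => μ) := by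
  rw [OPE, integral_smul_measure, withDensity_vandSq_univ hm, ENNReal.toReal_inv,
    ENNReal.toReal_ofReal (integral_vandSq_pos hs hm).le,
    integral_withDensity_eq_integral_toReal_smul measurable_vandSq.ennreal_ofReal
      (ae_of_all _ fun _ => ENNReal.ofReal_lt_top)]
  simp [ENNReal.toReal_ofReal (vandSq_nonneg _), mul_comm]

/-- Expectations of multiplicative statistics are ratios of moment determinants. -/
lemma integral_prod_OPE (hs : InfiniteSupport μ) (hm : HasAllMoments μ)
    (hg : Measurable g) (hC : ∀ x, |g x| ≤ C) :
    ∫ l, ∏ j, g (l j) ∂(OPE μ n) =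
      (momentMatrix μ n fun _ => 1).det⁻¹ * (momentMatrix μ n g).det := by
  rw [integral_OPE hs hm, integral_vandSq_eq hm, integral_prod_mul_vandSq hm hg hC]
  have : (n.factorial : ℝ) ≠ 0 := by positivity
  field_simp

lemma measurable_linStat (hg : Measurable g) : Measurable (linStat g : (Fin n → ℝ) → ℝ) := by
  unfold linStat
  fun_prop

lemma abs_linStat_le (hC : ∀ x, |g x| ≤ C) (l : Fin n → ℝ) : |linStat g l| ≤ n * C :=
  (Finset.abs_sum_le_sum_abs _ _).trans <| by
    simpa using Finset.sum_le_sum fun j (_ : j ∈ Finset.univ) => hC (l j)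

lemma integrable_linStat {P : Measure (Fin n → ℝ)} [IsFiniteMeasure P]
    (hg : Measurable g) (hC : ∀ x, |g x| ≤ C) : Integrable (linStat g) P :=
  .of_bound (measurable_linStat hg).aestronglyMeasurable (n * C)
    (ae_of_all _ (abs_linStat_le hC))

lemma integrable_exp_linStat {P : Measure (Fin n → ℝ)} [IsFiniteMeasure P]
    (hg : Measurable g) (hC : ∀ x, |g x| ≤ C) (t : ℝ) :
    Integrable (fun l => Real.exp (t * linStat g l)) P := by
  refine .of_bound (((measurable_linStat hg).const_mul t).exp).aestronglyMeasurable
    (Real.exp (|t| * (n * C))) (ae_of_all _ fun l => ?_)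
  rw [Real.norm_eq_abs, Real.abs_exp, Real.exp_le_exp]
  refine (le_abs_self _).trans ?_
  rw [abs_mul]
  exact mul_le_mul_of_nonneg_left (abs_linStat_le hC l) (abs_nonneg t)

/-- For `1 + g ≥ 0`, `E ∏ (1 + g(λ_j)) ≤ exp (E ∑ g(λ_j))`. -/
lemma integral_prod_one_add_OPE_le (hs : InfiniteSupport μ) (hm : HasAllMoments μ)
    (hg : Measurable g) (hC : ∀ x, |g x| ≤ C) (h0 : ∀ x, 0 ≤ 1 + g x) :
    ∫ l, ∏ j, (1 + g (l j)) ∂(OPE μ n) ≤ Real.exp (∫ l, linStat g l ∂(OPE μ n)) := by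
  have := isProbabilityMeasure_OPE (n := n) hs hm
  have hbd (s : ℝ) (x : ℝ) : |1 + s * g x| ≤ 1 + |s| * C := by
    refine (abs_add_le _ _).trans ?_
    rw [abs_one, abs_mul]
    gcongr
    exact hC x
  have hmeas (s : ℝ) : Measurable fun x => 1 + s * g x := (hg.const_mul s).const_add 1
  have hH := posDef_momentMatrix_one hs hm n
  have hHB : (momentMatrix μ n (fun _ => 1) + momentMatrix μ n g).PosSemidef := by
    have h := momentMatrix_one_add_smul (n := n) hm hg hC 1
    rw [one_smul] at h
    rw [← h]
    exact posSemidef_momentMatrix hm n (hmeas 1) (hbd 1) (by simpa using h0)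
  obtain ⟨T, q, hq, hT⟩ := exists_det_add_smul_eq_and_det_add_le_exp hH hHB
  have hD := hH.det_pos
  have hF (s : ℝ) :
      ∫ l, ∏ j, (1 + s * g (l j)) ∂(OPE μ n) = 1 + T * s + q.eval s * s ^ 2 := by
    rw [integral_prod_OPE (g := fun x => 1 + s * g x) hs hm (hmeas s) (hbd s),
      momentMatrix_one_add_smul hm hg hC, hq, inv_mul_cancel_left₀ hD.ne']
  set m := ∫ l, linStat g l ∂(OPE μ n)
  have hTm : T ≤ m := by
    set B : ℝ := n * C
    have hB : 0 ≤ B := mul_nonneg (Nat.cast_nonneg n) ((abs_nonneg _).trans (hC 0))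
    have hev : ∀ᶠ s in 𝓝[>] (0 : ℝ), T + q.eval s * s ≤ m + s * B ^ 2 := by
      have hlt : (0 : ℝ) < 1 / (B + 1) := by positivity
      filter_upwards [Ioo_mem_nhdsGT (lt_min hlt one_pos)] with s hs
      obtain ⟨hs0, hs1⟩ := hs
      have hsB : s * B ≤ 1 := by
        have := (lt_div_iff₀ (by positivity)).mp (hs1.trans_le (min_le_left _ _))
        linarith
      have hs1 : s ≤ 1 := (hs1.trans_le (min_le_right _ _)).le
      have hpt (l : Fin n → ℝ) :
          ∏ j, (1 + s * g (l j)) ≤ 1 + s * linStat g l + s ^ 2 * B ^ 2 := by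
        have hX : |linStat g l| ≤ B := abs_linStat_le hC l
        have hsX : |s * linStat g l| ≤ 1 := by
          rw [abs_mul, abs_of_pos hs0]
          exact (mul_le_mul_of_nonneg_left hX hs0.le).trans hsB
        have h1 : ∏ j, (1 + s * g (l j)) ≤ Real.exp (s * linStat g l) := by
          rw [linStat, Finset.mul_sum, Real.exp_sum]
          refine Finset.prod_le_prod (fun j _ => ?_) fun j _ => ?_
          · nlinarith [h0 (l j)]
          · linarith [Real.add_one_le_exp (s * g (l j))]
        have h2 := (abs_le.mp (Real.abs_exp_sub_one_sub_id_le hsX)).2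
        have h3 : (s * linStat g l) ^ 2 ≤ s ^ 2 * B ^ 2 := by
          rw [mul_pow]
          exact mul_le_mul_of_nonneg_left (sq_le_sq' (abs_le.mp hX).1 (abs_le.mp hX).2)
            (sq_nonneg s)
        linarith
      have hX : Integrable (fun l => 1 + s * linStat g l) (OPE μ n) :=
        (integrable_const 1).add ((integrable_linStat hg hC).const_mul s)
      have hle : 1 + T * s + q.eval s * s ^ 2 ≤ 1 + s * m + s ^ 2 * B ^ 2 := by
        rw [← hF s]
        refine (integral_mono_of_nonneg (ae_of_all _ fun l => Finset.prod_nonneg fun j _ => ?_)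
          (hX.add (integrable_const (s ^ 2 * B ^ 2))) (ae_of_all _ hpt)).trans_eq ?_
        · change 0 ≤ 1 + s * g (l j)
          nlinarith [h0 (l j)]
        · simp only [Pi.add_apply]
          rw [integral_add hX (integrable_const _), integral_add (integrable_const _)
            ((integrable_linStat hg hC).const_mul s), integral_const_mul]
          simp [m]
      nlinarith
    have hl : Tendsto (fun s : ℝ => T + q.eval s * s) (𝓝[>] 0) (𝓝 T) := by
      have : Continuous fun s : ℝ => T + q.eval s * s := by fun_prop
      simpa using (this.tendsto 0).mono_left nhdsWithin_le_nhds
    have hr : Tendsto (fun s : ℝ => m + s * B ^ 2) (𝓝[>] 0) (𝓝 m) := by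
      have : Continuous fun s : ℝ => m + s * B ^ 2 := by fun_prop
      simpa using (this.tendsto 0).mono_left nhdsWithin_le_nhds
    exact le_of_tendsto_of_tendsto hl hr hev
  have h1 := hF 1
  have h2 := hq 1
  rw [one_smul] at h2
  rw [h2] at hT
  simp only [one_mul] at h1
  rw [h1]
  exact (le_of_mul_le_mul_left hT hD).trans (Real.exp_le_exp.mpr hTm)

/-- Bound on the moment generating function of a linear statistic. -/
lemma mgf_linStat_OPE_le (hs : InfiniteSupport μ) (hm : HasAllMoments μ)
    (hg : Measurable g) (hC : ∀ x, |g x| ≤ C) {t : ℝ} (ht : |t| * C ≤ 1) :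
    mgf (linStat g) (OPE μ n) t ≤
      Real.exp (t * (∫ l, linStat g l ∂(OPE μ n)) + n * (t ^ 2 * C ^ 2)) := by
  have := isProbabilityMeasure_OPE (n := n) hs hm
  have htg (x : ℝ) : |t * g x| ≤ |t| * C := by
    rw [abs_mul]
    exact mul_le_mul_of_nonneg_left (hC x) (abs_nonneg t)
  have hmeas : Measurable fun x => Real.exp (t * g x) - 1 := by fun_prop
  have hbd (x : ℝ) : |Real.exp (t * g x) - 1| ≤ 2 := by
    have h1 := (htg x).trans ht
    linarith [Real.abs_exp_sub_one_le h1]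
  have hmain := integral_prod_one_add_OPE_le (n := n) hs hm hmeas hbd
    fun x => by simpa using (Real.exp_pos _).le
  have hprod (l : Fin n → ℝ) :
      ∏ j, (1 + (Real.exp (t * g (l j)) - 1)) = Real.exp (t * linStat g l) := by
    simp [linStat, Finset.mul_sum, Real.exp_sum]
  simp_rw [hprod] at hmain
  refine hmain.trans (Real.exp_le_exp.mpr ?_)
  have hint := integrable_linStat (P := OPE μ n) hg hC
  calc ∫ l, linStat (fun x => Real.exp (t * g x) - 1) l ∂(OPE μ n)
      ≤ ∫ l, (t * linStat g l + n * (t ^ 2 * C ^ 2)) ∂(OPE μ n) := by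
        refine integral_mono (integrable_linStat hmeas hbd)
          ((hint.const_mul t).add (integrable_const _)) fun l => ?_
        have hpt (x : ℝ) : Real.exp (t * g x) - 1 ≤ t * g x + t ^ 2 * C ^ 2 := by
          have h2 := (abs_le.mp (Real.abs_exp_sub_one_sub_id_le ((htg x).trans ht))).2
          have h3 : (t * g x) ^ 2 ≤ t ^ 2 * C ^ 2 := by
            rw [← sq_abs (t * g x), ← sq_abs t, ← mul_pow]
            gcongr
            exact htg x
          linarith
        simpa [linStat, Finset.sum_add_distrib, Finset.mul_sum] using
          Finset.sum_le_sum fun j (_ : j ∈ Finset.univ) => hpt (l j)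
    _ = _ := by
        rw [integral_add (hint.const_mul t) (integrable_const _), integral_const_mul]
        simp

end

/-- **Global concentration inequality for OPEs** (Theorem 1.1 / 1.4(I)):
there is a universal constant `A > 0` such that for every probability measure `μ` on `ℝ`
with infinite support and all moments finite, every bounded measurable `f`, every `ε > 0`
and every `n`, `P(|X_f/n - E[X_f]/n| ≥ ε) ≤ 2 exp(-nε min(ε/(8A‖f‖_∞²), 1/(6‖f‖_∞)))`. -/
theorem global_LLN_concentration :
    ∃ A : ℝ, 0 < A ∧
      ∀ (μ : Measure ℝ), IsProbabilityMeasure μ → InfiniteSupport μ → HasAllMoments μ →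
        ∀ f : ℝ → ℝ, Measurable f → (∃ C : ℝ, ∀ x, |f x| ≤ C) →
          ∀ ε : ℝ, 0 < ε → ∀ n : ℕ,
            (OPE μ n) {l | ε ≤ |linStat f l / n - (∫ l, linStat f l ∂(OPE μ n)) / n|} ≤
              ENNReal.ofReal (2 * Real.exp (-((n : ℝ) * ε *
                min (ε / (8 * A * supNorm f ^ 2)) (1 / (6 * supNorm f))))) := by
  refine ⟨1, one_pos, fun μ _ hs hm f hf hbdd ε hε n => ?_⟩
  have hP := isProbabilityMeasure_OPE (n := n) hs hm
  set c := supNorm f with hc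
  have hfc (x : ℝ) : |f x| ≤ c :=
    le_ciSup (f := fun x => |f x|) (hbdd.imp fun C hC => Set.forall_mem_range.mpr hC) x
  have htriv (h : (n : ℝ) * ε * min (ε / (8 * 1 * c ^ 2)) (1 / (6 * c)) = 0) :
      (OPE μ n) {l | ε ≤ |linStat f l / n - (∫ l, linStat f l ∂(OPE μ n)) / n|} ≤
        ENNReal.ofReal (2 * Real.exp (-((n : ℝ) * ε *
          min (ε / (8 * 1 * c ^ 2)) (1 / (6 * c))))) := by
    rw [h, neg_zero, Real.exp_zero, mul_one]
    exact prob_le_one.trans (by simp)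
  rcases ((abs_nonneg _).trans (hfc 0)).eq_or_lt with hc0 | hcpos
  · exact htriv (by simp [← hc0])
  rcases n.eq_zero_or_pos with rfl | hn
  · exact htriv (by simp)
  have hn' : (0 : ℝ) < n := Nat.cast_pos.mpr hn
  set m := ∫ l, linStat f l ∂(OPE μ n)
  set θ := min (ε / (8 * 1 * c ^ 2)) (1 / (6 * c)) with hθ
  have hθpos : 0 < θ := lt_min (by positivity) (by positivity)
  have hθ1 : θ * (8 * c ^ 2) ≤ ε := by
    have := min_le_left (ε / (8 * 1 * c ^ 2)) (1 / (6 * c))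
    rw [← hθ, le_div_iff₀ (by positivity)] at this
    linarith
  have hθ2 : θ * (6 * c) ≤ 1 := by
    have := min_le_right (ε / (8 * 1 * c ^ 2)) (1 / (6 * c))
    rwa [← hθ, le_div_iff₀ (by positivity)] at this
  -- Chernoff bound at t = ± 2θ.
  have hquad : n * ((2 * θ) ^ 2 * c ^ 2) ≤ n * ε * θ := by
    have : (2 * θ) ^ 2 * c ^ 2 ≤ ε * θ := by nlinarith [mul_pos hθpos hε]
    nlinarith
  have hupper : (OPE μ n).real {l | m + n * ε ≤ linStat f l} ≤ Real.exp (-(n * ε * θ)) := by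
    refine (measure_ge_le_exp_mul_mgf (t := 2 * θ) (m + n * ε) (by positivity)
      (integrable_exp_linStat hf hfc _)).trans ?_
    refine (mul_le_mul_of_nonneg_left (mgf_linStat_OPE_le (t := 2 * θ) hs hm hf hfc ?_)
      (Real.exp_pos _).le).trans ?_
    · rw [abs_of_pos (by positivity)]; nlinarith
    · rw [← Real.exp_add, Real.exp_le_exp]
      linarith
  have hlower : (OPE μ n).real {l | linStat f l ≤ m - n * ε} ≤ Real.exp (-(n * ε * θ)) := by
    refine (measure_le_le_exp_mul_mgf (t := -(2 * θ)) (m - n * ε) (by linarith)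
      (integrable_exp_linStat hf hfc _)).trans ?_
    refine (mul_le_mul_of_nonneg_left (mgf_linStat_OPE_le (t := -(2 * θ)) hs hm hf hfc ?_)
      (Real.exp_pos _).le).trans ?_
    · rw [abs_neg, abs_of_pos (by positivity)]; nlinarith
    · rw [← Real.exp_add, Real.exp_le_exp, neg_sq]
      linarith
  have hsub : {l : Fin n → ℝ | ε ≤ |linStat f l / n - m / n|} ⊆
      {l | m + n * ε ≤ linStat f l} ∪ {l | linStat f l ≤ m - n * ε} := by
    intro l hl
    rw [Set.mem_ofPred_eq, ← sub_div, abs_div, abs_of_pos hn', le_div_iff₀ hn', le_abs] at hl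
    rcases hl with h | h
    · left; rw [Set.mem_ofPred_eq]; linarith
    · right; rw [Set.mem_ofPred_eq]; linarith
  rw [← ofReal_measureReal]
  refine ENNReal.ofReal_le_ofReal ?_
  linarith [(measureReal_mono hsub).trans (measureReal_union_le (μ := OPE μ n) _ _)]

end
end

section
/- Let (μ_n)_{n≥1} be a sequence of probability measures on ℝ, each with infinite support and all moments finite, with Christoffel–Darboux kernels K_n(·,·;μ_n), and suppose that the measures (K_n(x,x)/n) dμ_n(x) converge weakly to a probability measure ν on ℝ. Then for every bounded continuous f : ℝ → ℝ and any sequence of random vectors λ^{(n)} ∈ ℝ^n defined on a common probability space, where λ^{(n)} is distributed according to the OPE of size n associated with μ_n, almost surely (1/n) Σ_{j=1}^n f(λ_j^{(n)}) → ∫ f dν as n → ∞. -/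
open MeasureTheory ProbabilityTheory Filter Topology

noncomputable section

/-- The Gram matrix `∫ p_i p_j g dμ` of the polynomials `p_0, …, p_{n-1}` with weight `g`. -/
def weightedGram (μ : Measure ℝ) (p : ℕ → Polynomial ℝ) (n : ℕ) (g : ℝ → ℝ) :
    Matrix (Fin n) (Fin n) ℝ :=
  Matrix.of fun i j => ∫ x, (p i).eval x * (p j).eval x * g x ∂μ

lemma HasAllMoments.integrable_eval {μ : Measure ℝ} (h : HasAllMoments μ) (q : Polynomial ℝ) :
    Integrable (fun x => q.eval x) μ := by
  simp_rw [Polynomial.eval_eq_sum_range]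
  exact integrable_finsetSum _ fun i _ => (h i).const_mul _

lemma HasAllMoments.integrable_eval_mul {μ : Measure ℝ} (h : HasAllMoments μ)
    (q : Polynomial ℝ) {g : ℝ → ℝ} (hg : Continuous g) {C : ℝ} (hC : ∀ x, |g x| ≤ C) :
    Integrable (fun x => q.eval x * g x) μ :=
  (h.integrable_eval q).mul_bdd hg.aestronglyMeasurable (ae_of_all _ hC)

lemma HasAllMoments.integrable_eval_mul_eval_mul {μ : Measure ℝ} (h : HasAllMoments μ)
    (q r : Polynomial ℝ) {g : ℝ → ℝ} (hg : Continuous g) {C : ℝ} (hC : ∀ x, |g x| ≤ C) :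
    Integrable (fun x => q.eval x * r.eval x * g x) μ := by
  simpa using h.integrable_eval_mul (q * r) hg hC

/-- The determinant of a positive semidefinite matrix `A` is at most `exp (tr (A - 1))`. -/
lemma Matrix.PosSemidef.det_le_exp_trace {n : ℕ} {A : Matrix (Fin n) (Fin n) ℝ}
    (hA : A.PosSemidef) : A.det ≤ Real.exp (A.trace - n) := by
  rw [hA.isHermitian.det_eq_prod_eigenvalues, hA.isHermitian.trace_eq_sum_eigenvalues]
  have : (∑ i, ((hA.isHermitian.eigenvalues i : ℝ))) - n
      = ∑ i, (hA.isHermitian.eigenvalues i - 1) := by simp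
  simp only [RCLike.ofReal_real_eq_id, id]
  rw [this, Real.exp_sum]
  refine Finset.prod_le_prod (fun i _ => hA.eigenvalues_nonneg i) fun i _ => ?_
  simpa using Real.add_one_le_exp (hA.isHermitian.eigenvalues i - 1)

lemma posSemidef_weightedGram {μ : Measure ℝ} (h : HasAllMoments μ) (p : ℕ → Polynomial ℝ)
    (n : ℕ) {g : ℝ → ℝ} (hg : Continuous g) (hg0 : ∀ x, 0 ≤ g x) {C : ℝ} (hC : ∀ x, |g x| ≤ C) :
    (weightedGram μ p n g).PosSemidef := by
  refine Matrix.PosSemidef.of_dotProduct_mulVec_nonneg ?_ fun v => ?_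
  · ext i j
    simp [weightedGram, mul_comm]
  · have : star v ⬝ᵥ (weightedGram μ p n g).mulVec v
        = ∫ x, (∑ i, v i * (p i).eval x) ^ 2 * g x ∂μ := by
      simp_rw [pow_two, Finset.sum_mul_sum, Finset.sum_mul]
      have hint (i j : Fin n) : Integrable
          (fun x => v i * (p i).eval x * (v j * (p j).eval x) * g x) μ :=
        ((h.integrable_eval_mul_eval_mul (p i) (p j) hg hC).const_mul (v i * v j)).congr
          (ae_of_all _ fun x => by ring)
      rw [integral_finsetSum _ fun i _ => integrable_finsetSum _ fun j _ => hint i j]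
      refine Finset.sum_congr rfl fun i _ => ?_
      rw [integral_finsetSum _ fun j _ => hint i j, Matrix.mulVec, dotProduct, Finset.mul_sum]
      refine Finset.sum_congr rfl fun j _ => ?_
      simp only [weightedGram, Matrix.of_apply, Pi.star_apply, star_trivial]
      rw [mul_comm (∫ _, _ ∂μ), ← mul_assoc, ← integral_const_mul]
      congr 1 with x
      ring
    rw [this]
    exact integral_nonneg fun x => mul_nonneg (sq_nonneg _) (hg0 x)

/-- Andréief's identity. -/
lemma integral_det_sq_mul_prod {μ : Measure ℝ} [IsProbabilityMeasure μ] (h : HasAllMoments μ)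
    (p : ℕ → Polynomial ℝ) (n : ℕ) {g : ℝ → ℝ} (hg : Continuous g) {C : ℝ}
    (hC : ∀ x, |g x| ≤ C) :
    ∫ l : Fin n → ℝ, (Matrix.of fun i j : Fin n => (p j).eval (l i)).det ^ 2 * ∏ i, g (l i)
      ∂(Measure.pi fun _ => μ) = n.factorial * (weightedGram μ p n g).det := by
  have hexp (l : Fin n → ℝ) :
      (Matrix.of fun i j : Fin n => (p j).eval (l i)).det ^ 2 * ∏ i, g (l i)
        = ∑ σ : Equiv.Perm (Fin n), ∑ τ : Equiv.Perm (Fin n),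
          ((σ.sign : ℤ) : ℝ) * ((τ.sign : ℤ) : ℝ) *
            ∏ i, ((p (σ i)).eval (l i) * (p (τ i)).eval (l i) * g (l i)) := by
    rw [← Matrix.det_transpose, Matrix.det_apply', pow_two, Finset.sum_mul_sum, Finset.sum_mul]
    refine Finset.sum_congr rfl fun σ _ => ?_
    rw [Finset.sum_mul]
    refine Finset.sum_congr rfl fun τ _ => ?_
    simp only [Matrix.transpose_apply, Matrix.of_apply, Finset.prod_mul_distrib]
    ring
  simp_rw [hexp]
  have hint (σ τ : Equiv.Perm (Fin n)) : Integrable (fun l : Fin n → ℝ =>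
      ((σ.sign : ℤ) : ℝ) * ((τ.sign : ℤ) : ℝ) *
        ∏ i, ((p (σ i)).eval (l i) * (p (τ i)).eval (l i) * g (l i)))
      (Measure.pi fun _ => μ) :=
    (Integrable.fintype_prod (f := fun i x => (p (σ i)).eval x * (p (τ i)).eval x * g x)
      fun i => h.integrable_eval_mul_eval_mul _ _ hg hC).const_mul _
  rw [integral_finsetSum _ fun σ _ => integrable_finsetSum _ fun τ _ => hint σ τ]
  have hσ (σ : Equiv.Perm (Fin n)) : ∫ l : Fin n → ℝ, ∑ τ : Equiv.Perm (Fin n),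
      ((σ.sign : ℤ) : ℝ) * ((τ.sign : ℤ) : ℝ) *
        ∏ i, ((p (σ i)).eval (l i) * (p (τ i)).eval (l i) * g (l i))
      ∂(Measure.pi fun _ => μ) = (weightedGram μ p n g).det := by
    have hdet : (weightedGram μ p n g).det
        = ((σ.sign : ℤ) : ℝ) * ((weightedGram μ p n g).submatrix σ id).det := by
      rw [Matrix.det_permute, ← mul_assoc, ← Int.cast_mul, ← Units.val_mul, Int.units_mul_self]
      simp
    rw [integral_finsetSum _ fun τ _ => hint σ τ, hdet, ← Matrix.det_transpose,
      Matrix.det_apply', Finset.mul_sum]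
    refine Finset.sum_congr rfl fun τ _ => ?_
    rw [integral_const_mul, mul_assoc, integral_fintype_prod_eq_prod
      (f := fun (i : Fin n) (x : ℝ) => (p (σ i)).eval x * (p (τ i)).eval x * g x)]
    simp [weightedGram]
  simp_rw [hσ]
  simp [Fintype.card_perm]

lemma vandSq_eq_det_vandermonde_sq {n : ℕ} (l : Fin n → ℝ) :
    vandSq l = (Matrix.vandermonde l).det ^ 2 := by
  rw [Matrix.det_vandermonde, vandSq, ← Finset.prod_pow]
  simp_rw [← Finset.prod_pow]
  rw [Finset.prod_filter, Fintype.prod_prod_type_right]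
  refine Finset.prod_congr rfl fun i _ => ?_
  rw [← Finset.prod_filter]
  exact Finset.prod_congr (by ext; simp) fun _ _ => rfl

lemma IsOrthonormalPolys.det_eval_sq {μ : Measure ℝ} {p : ℕ → Polynomial ℝ}
    (hp : IsOrthonormalPolys μ p) {n : ℕ} (l : Fin n → ℝ) :
    (Matrix.of fun i j : Fin n => (p j).eval (l i)).det ^ 2
      = (∏ j : Fin n, (p j).leadingCoeff) ^ 2 * vandSq l := by
  have hdeg (j : ℕ) : (p j).natDegree = j := Polynomial.natDegree_eq_of_degree_eq_some (hp.1 j)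
  have htri : (Matrix.of fun i j : Fin n => (p j).coeff i).det
      = ∏ j : Fin n, (p j).leadingCoeff := by
    rw [Matrix.det_of_isUpperTriangular]
    · simp [Polynomial.leadingCoeff, hdeg]
    · intro i j hij
      refine Polynomial.coeff_eq_zero_of_natDegree_lt ?_
      rw [hdeg]
      exact hij
  rw [Matrix.eval_matrixOfPolynomials_eq_vandermonde_mul_matrixOfPolynomials l
    (fun j : Fin n => p j) fun i => (hdeg i).le, Matrix.det_mul, vandSq_eq_det_vandermonde_sq,
    htri, mul_pow, mul_comm]

lemma IsOrthonormalPolys.weightedGram_one {μ : Measure ℝ} {p : ℕ → Polynomial ℝ}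
    (hp : IsOrthonormalPolys μ p) (n : ℕ) : weightedGram μ p n (fun _ => 1) = 1 := by
  ext i j
  simp [weightedGram, hp.2.2, Matrix.one_apply, Fin.ext_iff]

/-- Multiplicative statistics of the orthogonal polynomial ensemble are Gram determinants. -/
lemma integral_prod_OPE_s1 {μ : Measure ℝ} [IsProbabilityMeasure μ] (h : HasAllMoments μ)
    {p : ℕ → Polynomial ℝ} (hp : IsOrthonormalPolys μ p) (n : ℕ) {g : ℝ → ℝ}
    (hg : Continuous g) {C : ℝ} (hC : ∀ x, |g x| ≤ C) :
    ∫ l, ∏ i, g (l i) ∂(OPE μ n) = (weightedGram μ p n g).det := by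
  set c := (∏ j : Fin n, (p j).leadingCoeff) ^ 2 with hc
  have hc0 : 0 < c := pow_pos (Finset.prod_pos fun (j : Fin n) _ => hp.2.1 j) 2
  have key {g : ℝ → ℝ} (hg : Continuous g) {C : ℝ} (hC : ∀ x, |g x| ≤ C) :
      c * ∫ l : Fin n → ℝ, vandSq l * ∏ i, g (l i) ∂(Measure.pi fun _ => μ)
        = n.factorial * (weightedGram μ p n g).det := by
    rw [← integral_det_sq_mul_prod h p n hg hC, ← integral_const_mul]
    simp_rw [hp.det_eval_sq, mul_assoc, hc]
  have key1 := key (g := fun _ => 1) continuous_const (C := 1) (by simp)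
  simp only [hp.weightedGram_one, Matrix.det_one, Finset.prod_const_one, mul_one] at key1
  have hfac : (0 : ℝ) < n.factorial := mod_cast n.factorial_pos
  have hpos : 0 < ∫ l : Fin n → ℝ, vandSq l ∂(Measure.pi fun _ => μ) :=
    pos_of_mul_pos_right (key1 ▸ hfac) hc0.le
  have hint : Integrable (vandSq : (Fin n → ℝ) → ℝ) (Measure.pi fun _ => μ) :=
    by_contra fun hn => hpos.ne' (integral_undef hn)
  have hZ : ((Measure.pi fun _ : Fin n => μ).withDensity fun l => ENNReal.ofReal (vandSq l))
      Set.univ = ENNReal.ofReal (∫ l : Fin n → ℝ, vandSq l ∂(Measure.pi fun _ => μ)) := by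
    rw [withDensity_apply _ MeasurableSet.univ, Measure.restrict_univ,
      ofReal_integral_eq_lintegral_ofReal hint (ae_of_all _ vandSq_nonneg)]
  rw [OPE, integral_smul_measure, hZ, integral_withDensity_eq_integral_toReal_smul
    measurable_vandSq.ennreal_ofReal (ae_of_all _ fun _ => ENNReal.ofReal_lt_top)]
  simp_rw [ENNReal.toReal_ofReal (vandSq_nonneg _), smul_eq_mul]
  rw [ENNReal.toReal_inv, ENNReal.toReal_ofReal hpos.le, inv_mul_eq_iff_eq_mul₀ hpos.ne']
  refine mul_left_cancel₀ hc0.ne' ?_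
  rw [key hg hC, ← mul_assoc, key1]

lemma CDKernel_self_nonneg (p : ℕ → Polynomial ℝ) (n : ℕ) (x : ℝ) : 0 ≤ CDKernel p n x x :=
  Finset.sum_nonneg fun _ _ => mul_self_nonneg _

lemma HasAllMoments.integrable_CDKernel_mul {μ : Measure ℝ} (h : HasAllMoments μ)
    (p : ℕ → Polynomial ℝ) (n : ℕ) {g : ℝ → ℝ} (hg : Continuous g) {C : ℝ}
    (hC : ∀ x, |g x| ≤ C) : Integrable (fun x => CDKernel p n x x * g x) μ := by
  simp_rw [CDKernel, Finset.sum_mul]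
  exact integrable_finsetSum _ fun i _ => h.integrable_eval_mul_eval_mul _ _ hg hC

lemma trace_weightedGram {μ : Measure ℝ} (h : HasAllMoments μ) (p : ℕ → Polynomial ℝ) (n : ℕ)
    {g : ℝ → ℝ} (hg : Continuous g) {C : ℝ} (hC : ∀ x, |g x| ≤ C) :
    (weightedGram μ p n g).trace = ∫ x, CDKernel p n x x * g x ∂μ := by
  simp_rw [CDKernel, Finset.sum_mul]
  rw [integral_finsetSum _ fun i _ => h.integrable_eval_mul_eval_mul _ _ hg hC,
    Finset.sum_range]
  rfl

/-- Sub-Gaussian bound on the Laplace transform of a linear statistic. -/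
lemma integral_exp_linStat_OPE_le {μ : Measure ℝ} [IsProbabilityMeasure μ] (h : HasAllMoments μ)
    {p : ℕ → Polynomial ℝ} (hp : IsOrthonormalPolys μ p) (n : ℕ) {f : ℝ → ℝ}
    (hf : Continuous f) {C : ℝ} (hC : ∀ x, |f x| ≤ C) {t : ℝ} (ht : 0 ≤ t) (htC : t * C ≤ 1) :
    ∫ l, Real.exp (t * linStat f l) ∂(OPE μ n)
      ≤ Real.exp (t * ∫ x, f x * CDKernel p n x x ∂μ + (t * C) ^ 2 * n) := by
  have hle (x : ℝ) : |t * f x| ≤ t * C := by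
    rw [abs_mul, abs_of_nonneg ht]
    exact mul_le_mul_of_nonneg_left (hC x) ht
  have hg : Continuous fun x => Real.exp (t * f x) := by fun_prop
  have hgC (x : ℝ) : |Real.exp (t * f x)| ≤ Real.exp (t * C) := by
    rw [Real.abs_exp, Real.exp_le_exp]
    exact (le_abs_self _).trans (hle x)
  have hprod (l : Fin n → ℝ) :
      Real.exp (t * linStat f l) = ∏ i, Real.exp (t * f (l i)) := by
    rw [linStat, Finset.mul_sum, Real.exp_sum]
  simp_rw [hprod]
  rw [integral_prod_OPE_s1 h hp n hg hgC]
  have hpsd := posSemidef_weightedGram h p n hg (fun _ => (Real.exp_pos _).le) hgC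
  refine hpsd.det_le_exp_trace.trans (Real.exp_le_exp.2 ?_)
  have hint1 := h.integrable_CDKernel_mul p n (g := fun _ => 1) continuous_const (C := 1) (by simp)
  have hone : ∫ x, CDKernel p n x x * 1 ∂μ = n := by
    rw [← trace_weightedGram h p n (g := fun _ => 1) continuous_const (C := 1) (by simp),
      hp.weightedGram_one]
    simp
  have hintf := h.integrable_CDKernel_mul p n hf hC
  have hbound : ∫ x, CDKernel p n x x * Real.exp (t * f x) ∂μ
      ≤ ∫ x, ((1 + (t * C) ^ 2) * (CDKernel p n x x * 1) + t * (CDKernel p n x x * f x)) ∂μ := by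
    refine integral_mono (h.integrable_CDKernel_mul p n hg hgC)
      ((hint1.const_mul _).add (hintf.const_mul _)) fun x => ?_
    have h1 := (abs_le.1 (Real.abs_exp_sub_one_sub_id_le ((hle x).trans htC))).2
    have h2 : (t * f x) ^ 2 ≤ (t * C) ^ 2 := sq_le_sq' (abs_le.1 (hle x)).1 (abs_le.1 (hle x)).2
    have h3 : Real.exp (t * f x) ≤ 1 + (t * C) ^ 2 + t * f x := by linarith
    have h4 := mul_le_mul_of_nonneg_left h3 (CDKernel_self_nonneg p n x)
    dsimp only
    linarith
  rw [integral_add (hint1.const_mul _) (hintf.const_mul _), integral_const_mul,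
    integral_const_mul, hone] at hbound
  rw [trace_weightedGram h p n hg hgC]
  simp_rw [mul_comm (f _)]
  linarith

/-- Chernoff bound for the upper tail of a linear statistic. -/
lemma measureReal_linStat_ge_le {μ : Measure ℝ} [IsProbabilityMeasure μ] (h : HasAllMoments μ)
    {p : ℕ → Polynomial ℝ} (hp : IsOrthonormalPolys μ p) (n : ℕ) {f : ℝ → ℝ}
    (hf : Continuous f) {C : ℝ} (hC1 : 1 ≤ C) (hC : ∀ x, |f x| ≤ C)
    {Ω : Type*} [MeasurableSpace Ω] {P : Measure Ω} [IsProbabilityMeasure P]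
    {L : Ω → Fin n → ℝ} (hL : Measurable L) (hlaw : P.map L = OPE μ n)
    {ε : ℝ} (hε0 : 0 < ε) (hε1 : ε ≤ 1) :
    P.real {ω | (∫ x, f x * CDKernel p n x x ∂μ) + ε * n ≤ linStat f (L ω)}
      ≤ Real.exp (-(ε ^ 2 / (4 * C ^ 2))) ^ n := by
  have hC0 : 0 < C := by linarith
  set t := ε / (2 * C ^ 2) with ht
  have ht0 : 0 ≤ t := by positivity
  have htC : t * C ≤ 1 := by
    have : t * C = ε / (2 * C) := by rw [ht]; field_simp
    rw [this, div_le_one (by positivity)]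
    linarith
  have hmeas : Measurable fun l : Fin n → ℝ => Real.exp (t * linStat f l) := by
    unfold linStat
    have := hf.measurable
    fun_prop
  have hint : Integrable (fun ω => Real.exp (t * linStat f (L ω))) P := by
    refine Integrable.of_bound (hmeas.comp hL).aestronglyMeasurable (Real.exp (t * (n * C)))
      (ae_of_all _ fun ω => ?_)
    rw [Real.norm_eq_abs, Real.abs_exp, Real.exp_le_exp]
    refine mul_le_mul_of_nonneg_left ?_ ht0
    refine (Finset.sum_le_sum fun i _ => (le_abs_self _).trans (hC (L ω i))).trans ?_
    simp
  refine (measure_ge_le_exp_mul_mgf _ ht0 hint).trans ?_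
  have hmgf : mgf (fun ω => linStat f (L ω)) P t
      ≤ Real.exp (t * ∫ x, f x * CDKernel p n x x ∂μ + (t * C) ^ 2 * n) := by
    rw [mgf, ← integral_map (f := fun l => Real.exp (t * linStat f l)) hL.aemeasurable
      hmeas.aestronglyMeasurable, hlaw]
    exact integral_exp_linStat_OPE_le h hp n hf hC ht0 htC
  refine (mul_le_mul_of_nonneg_left hmgf (Real.exp_pos _).le).trans_eq ?_
  rw [← Real.exp_add, ← Real.exp_nat_mul]
  congr 1
  rw [ht]
  field_simp
  ring

lemma ae_eventually_linStat_lt {μ : ℕ → Measure ℝ} (hprob : ∀ n, IsProbabilityMeasure (μ n))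
    (hmom : ∀ n, HasAllMoments (μ n)) {p : ℕ → ℕ → Polynomial ℝ}
    (hp : ∀ n, IsOrthonormalPolys (μ n) (p n)) {f : ℝ → ℝ}
    (hf : Continuous f) {C : ℝ} (hC1 : 1 ≤ C) (hC : ∀ x, |f x| ≤ C)
    {Ω : Type*} [MeasurableSpace Ω] {P : Measure Ω} [IsProbabilityMeasure P]
    {Λ : (n : ℕ) → Ω → (Fin n → ℝ)} (hΛmeas : ∀ n, Measurable (Λ n))
    (hΛlaw : ∀ n, Measure.map (Λ n) P = OPE (μ n) n) {ε : ℝ} (hε0 : 0 < ε) (hε1 : ε ≤ 1) :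
    ∀ᵐ ω ∂P, ∀ᶠ n : ℕ in atTop,
      linStat f (Λ n ω) < (∫ x, f x * CDKernel (p n) n x x ∂(μ n)) + ε * n := by
  have hr : Real.exp (-(ε ^ 2 / (4 * C ^ 2))) < 1 := by
    have : 0 < C := by linarith
    rw [Real.exp_lt_one_iff, neg_lt_zero]
    positivity
  have hsum : ∑' n : ℕ, P {ω | (∫ x, f x * CDKernel (p n) n x x ∂(μ n)) + ε * n
      ≤ linStat f (Λ n ω)} ≠ ⊤ := by
    refine ne_top_of_le_ne_top
      (summable_geometric_of_lt_one (Real.exp_pos _).le hr).tsum_ofReal_ne_top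
      (ENNReal.tsum_le_tsum fun n => ?_)
    rw [← ofReal_measureReal]
    have := hprob n
    exact ENNReal.ofReal_le_ofReal
      (measureReal_linStat_ge_le (hmom n) (hp n) n hf hC1 hC (hΛmeas n) (hΛlaw n) hε0 hε1)
  filter_upwards [ae_eventually_notMem hsum] with ω hω
  filter_upwards [hω] with n hn
  simpa using hn

/-- **Global law of large numbers for OPEs** (Theorem 1.1, second part): if
`(K_n(x,x)/n) dμ_n` converges weakly to a probability measure `ν`, then for every bounded
continuous `f` and any sequence of random vectors distributed according to the OPEs on a
common probability space, almost surely `(1/n) Σ f(λ_j^{(n)}) → ∫ f dν`. -/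
theorem global_LLN
    (μ : ℕ → Measure ℝ) (hprob : ∀ n, IsProbabilityMeasure (μ n))
    (hinf : ∀ n, InfiniteSupport (μ n)) (hmom : ∀ n, HasAllMoments (μ n))
    (p : ℕ → ℕ → Polynomial ℝ) (hp : ∀ n, IsOrthonormalPolys (μ n) (p n))
    (ν : Measure ℝ) (hν : IsProbabilityMeasure ν)
    (hweak : ∀ g : ℝ → ℝ, Continuous g → (∃ C : ℝ, ∀ x, |g x| ≤ C) →
      Tendsto (fun n : ℕ => ∫ x, g x * (CDKernel (p n) n x x / n) ∂(μ n)) atTop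
        (𝓝 (∫ x, g x ∂ν)))
    (f : ℝ → ℝ) (hf : Continuous f) (hfb : ∃ C : ℝ, ∀ x, |f x| ≤ C)
    (Ω : Type*) [MeasurableSpace Ω] (P : Measure Ω) (hP : IsProbabilityMeasure P)
    (Λ : (n : ℕ) → Ω → (Fin n → ℝ)) (hΛmeas : ∀ n, Measurable (Λ n))
    (hΛlaw : ∀ n, Measure.map (Λ n) P = OPE (μ n) n) :
    ∀ᵐ ω ∂P,
      Tendsto (fun n : ℕ => (1 / (n : ℝ)) * linStat f (Λ n ω)) atTop
        (𝓝 (∫ x, f x ∂ν)) := by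
  obtain ⟨C₀, hC₀⟩ := hfb
  set C := max C₀ 1
  have hC1 : 1 ≤ C := le_max_right _ _
  have hC (x : ℝ) : |f x| ≤ C := (hC₀ x).trans (le_max_left _ _)
  set m : ℕ → ℝ := fun n => ∫ x, f x * CDKernel (p n) n x x ∂(μ n) with hm
  have hmlim : Tendsto (fun n : ℕ => m n / n) atTop (𝓝 (∫ x, f x ∂ν)) := by
    refine (hweak f hf ⟨C, hC⟩).congr fun n => ?_
    rw [hm, ← integral_div]
    simp_rw [mul_div_assoc]
  have hk (k : ℕ) : ∀ᵐ ω ∂P, ∀ᶠ n : ℕ in atTop,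
      |linStat f (Λ n ω) - m n| < 1 / ((k : ℝ) + 1) * n := by
    have hε0 : (0 : ℝ) < 1 / ((k : ℝ) + 1) := by positivity
    have hε1 : 1 / ((k : ℝ) + 1) ≤ 1 := by
      rw [div_le_one (by positivity)]
      simp
    filter_upwards [ae_eventually_linStat_lt hprob hmom hp hf hC1 hC hΛmeas hΛlaw hε0 hε1,
      ae_eventually_linStat_lt hprob hmom hp hf.neg hC1 (by simpa using hC) hΛmeas hΛlaw
        hε0 hε1] with ω h1 h2
    filter_upwards [h1, h2] with n h1 h2
    simp only [linStat, Finset.sum_neg_distrib, Pi.neg_apply, neg_mul, integral_neg] at h1 h2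
    rw [abs_lt, linStat, hm]
    constructor <;> dsimp only <;> linarith
  filter_upwards [ae_all_iff.2 hk] with ω hω
  have hdiff : Tendsto (fun n : ℕ => 1 / (n : ℝ) * linStat f (Λ n ω) - m n / n) atTop (𝓝 0) := by
    rw [Metric.tendsto_nhds]
    intro ε hε
    obtain ⟨k, hkε⟩ := exists_nat_one_div_lt hε
    filter_upwards [hω k, eventually_gt_atTop 0] with n hn hn0
    have hn0' : (0 : ℝ) < n := mod_cast hn0
    rw [Real.dist_eq, sub_zero, one_div_mul_eq_div, ← sub_div, abs_div, abs_of_pos hn0',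
      div_lt_iff₀ hn0']
    exact hn.trans (mul_lt_mul_of_pos_right hkε hn0')
  simpa using hdiff.add hmlim
end
end
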